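/- Let 𝒜 be primitive with constant N, δ as above, t > 1, and 1/t + 1/q = 1. Let μ be a Gibbs state for (𝒜, t) with constant C and pressure P. Then μ([I] ∩ σ^{-N-|J|}[J]) ≥ C^{-2} e^{-NP} M^{-Nt/q} δ^t μ([I])μ([J]) for all words I, J, where M = |Σ|. -/

import Mathlib

open MeasureTheory

/-- The left shift on the two-sided full shift space. -/
def shift {α : Type*} : (ℤ → α) → (ℤ → α) := fun x n => x (n + 1)

/-- The cylinder set determined by a word `I`, occupying coordinates
`-|I|, …, -1` (two-sided shift convention). -/
def cyl {M : ℕ} {m : ℕ} (I : Fin m → Fin M) : Set (ℤ → Fin M) :=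
  {x | ∀ i : Fin m, x ((i : ℕ) - (m : ℤ)) = I i}

/-- The ordered product `A_{x₀} A_{x₁} ⋯ A_{x_{n-1}}`. -/
noncomputable def wprod {M d : ℕ}
    (A : Fin M → (EuclideanSpace ℝ (Fin d) →L[ℝ] EuclideanSpace ℝ (Fin d)))
    {n : ℕ} (x : Fin n → Fin M) :
    EuclideanSpace ℝ (Fin d) →L[ℝ] EuclideanSpace ℝ (Fin d) :=
  (List.ofFn fun i => A (x i)).prod

open Filter Topology in
theorem erg_avg {α : Type*} [MeasurableSpace α] {μ : Measure α} [IsProbabilityMeasure μ]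
    {f : α → α} (hf : Ergodic f μ) {A B : Set α} (hA : MeasurableSet A) (hB : MeasurableSet B)
    {y : ℝ} (hy : ∀ k : ℕ, μ.real (B ∩ f^[k] ⁻¹' A) ≤ y) : μ.real B * μ.real A ≤ y := by
  have hmp := hf.toMeasurePreserving
  let U := Lp.compMeasurePreservingₗᵢ (E := ℝ) (p := 2) ℝ f hmp
  let g : Lp ℝ 2 μ := indicatorConstLp 2 hA (measure_ne_top μ A) 1
  let h : Lp ℝ 2 μ := indicatorConstLp 2 hB (measure_ne_top μ B) 1
  let e : Lp ℝ 2 μ := indicatorConstLp 2 MeasurableSet.univ (measure_ne_top μ _) 1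
  let T := U.toContinuousLinearMap
  have hit : ∀ n : ℕ, T^[n] g =
      indicatorConstLp 2 ((hmp.iterate n).measurable hA) (measure_ne_top μ _) 1 := by
    intro n
    have h1 : (T : Lp ℝ 2 μ → Lp ℝ 2 μ) = Lp.compMeasurePreserving f hmp := rfl
    rw [h1, Lp.compMeasurePreserving_iterate]
    exact Lp.indicatorConstLp_compMeasurePreserving hA _ _ (hmp.iterate n)
  have key := T.tendsto_birkhoffAverage_orthogonalProjection
    U.norm_toContinuousLinearMap_le g
  set p : Lp ℝ 2 μ := ((T.eqLocus (1 : Lp ℝ 2 μ →L[ℝ] Lp ℝ 2 μ)).orthogonalProjectionOnto g : Lp ℝ 2 μ) with hp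
  have hinn : ∀ C (hC : MeasurableSet C) (n : ℕ), inner ℝ (indicatorConstLp 2 hC (measure_ne_top μ C) (1:ℝ)) 
      (birkhoffAverage ℝ T _root_.id n g) = (n:ℝ)⁻¹ * ∑ k ∈ Finset.range n, μ.real (C ∩ f^[k] ⁻¹' A) := by
    intro C hC n
    simp only [birkhoffAverage, birkhoffSum, id, hit, inner_smul_right, inner_sum]
    congr 1
    refine Finset.sum_congr rfl fun k _ => ?_
    rw [L2.real_inner_indicatorConstLp_one_indicatorConstLp_one]
  have hlim : ∀ C (hC : MeasurableSet C), Tendsto (fun n : ℕ => (n:ℝ)⁻¹ * ∑ k ∈ Finset.range n, μ.real (C ∩ f^[k] ⁻¹' A)) atTop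
     (𝓝 (inner ℝ (indicatorConstLp 2 hC (measure_ne_top μ C) (1:ℝ)) p)) := by
    intro C hC
    simp_rw [← hinn C hC]
    exact tendsto_const_nhds.inner key
  have hfix : T p = p := by
    have := ((T.eqLocus (1 : Lp ℝ 2 μ →L[ℝ] Lp ℝ 2 μ)).orthogonalProjectionOnto g).2
    exact LinearMap.mem_eqLocus.1 this
  obtain ⟨c, hc⟩ : ∃ c : ℝ, (p : α → ℝ) =ᵐ[μ] Function.const α c := by
    apply hf.ae_eq_const_of_ae_eq_comp_ae (Lp.aestronglyMeasurable p)
    have h1 : T p = Lp.compMeasurePreserving f hmp p := rfl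
    have h2 := Lp.coeFn_compMeasurePreserving p hmp
    rw [← h1, hfix] at h2
    exact h2.symm
  have hinp : ∀ C (hC : MeasurableSet C), inner ℝ (indicatorConstLp 2 hC (measure_ne_top μ C) (1:ℝ)) p = μ.real C * c := by
    intro C hC
    rw [L2.inner_indicatorConstLp_one]
    rw [setIntegral_congr_ae (g := fun _ => c) hC (hc.mono fun x hx _ => hx)]
    simp
  have hcA : c = μ.real A := by
    have h1 := hlim Set.univ MeasurableSet.univ
    rw [hinp] at h1
    simp only [probReal_univ, one_mul, Set.univ_inter] at h1
    have h2 : ∀ k, μ.real (f^[k] ⁻¹' A) = μ.real A := fun k =>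
      (hmp.iterate k).measureReal_preimage hA.nullMeasurableSet
    simp only [h2] at h1
    refine tendsto_nhds_unique h1 (tendsto_const_nhds.congr' ?_)
    filter_upwards [eventually_gt_atTop 0] with n hn
    have : (n:ℝ) ≠ 0 := by positivity
    simp; field_simp
  have h3 := hlim B hB
  rw [hinp, hcA] at h3
  refine le_of_tendsto h3 ?_
  filter_upwards [eventually_gt_atTop 0] with n hn
  have hn' : (0:ℝ) < n := by positivity
  rw [inv_mul_le_iff₀ hn']
  calc _ ≤ ∑ k ∈ Finset.range n, y := Finset.sum_le_sum fun k _ => hy k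
    _ = _ := by simp

open scoped symmDiff in
theorem erg_crit {α : Type*} [mα : MeasurableSpace α] {μ : Measure α} [IsProbabilityMeasure μ]
    {f : α → α} (hmp : MeasurePreserving f μ μ) {R : Set (Set α)} (hR : IsSetRing R)
    (huniv : Set.univ ∈ R) (hgen : mα = MeasurableSpace.generateFrom R) (c : ℝ) (hc : 0 < c)
    (h : ∀ E ∈ R, ∀ F ∈ R, ∃ n : ℕ, c * (μ.real E * μ.real F) ≤ μ.real (E ∩ f^[n] ⁻¹' F)) :
    Ergodic f μ := by
  refine ⟨hmp, ⟨fun S hS hinv => ?_⟩⟩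
  have hinvn : ∀ n : ℕ, f^[n] ⁻¹' S = S := by
    intro n
    rw [Set.preimage_iterate_eq]
    exact Function.iterate_fixed hinv n
  have hmeas : ∀ E ∈ R, MeasurableSet E := fun E hE => by
    rw [hgen]; exact MeasurableSpace.measurableSet_generateFrom hE
  have happ : ∀ S, MeasurableSet S → ∀ ε : ℝ, 0 < ε → ∃ E ∈ R, μ.real (E ∆ S) < ε := by
    intro S hS ε hε
    obtain ⟨t, ht, h1⟩ := exists_measure_symmDiff_lt_of_generateFrom_isSetRing (μ := μ) hR
      ⟨{Set.univ}, by simp, by simpa using huniv, by simp⟩ hgen hS (ε := ENNReal.ofReal ε) (by simpa using hε)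
    exact ⟨t, ht, (ENNReal.lt_ofReal_iff_toReal_lt (measure_ne_top _ _)).1 h1⟩
  have hbd : ∀ ε : ℝ, 0 < ε → c * (μ.real S * μ.real Sᶜ) ≤ 0 + ε * (2 + 2 * c) := by
    intro ε hε
    obtain ⟨E, hE, hES⟩ := happ S hS ε hε
    obtain ⟨F, hF, hFS⟩ := happ Sᶜ hS.compl ε hε
    obtain ⟨n, hn⟩ := h E hE F hF
    have h1 : μ.real (E ∩ f^[n] ⁻¹' F) ≤ μ.real (E ∆ S) + μ.real (F ∆ Sᶜ) := by
      rw [← (hmp.iterate n).measureReal_preimage (s := F ∆ Sᶜ)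
        ((hmeas F hF).symmDiff hS.compl).nullMeasurableSet]
      refine (measureReal_mono ?_).trans (measureReal_union_le _ _)
      intro x ⟨hx1, hx2⟩
      have h4 : f^[n] x ∈ S ↔ x ∈ S := by
        rw [← Set.mem_preimage, hinvn n]
      simp only [Set.mem_preimage] at hx2
      simp only [Set.mem_union, Set.mem_symmDiff, Set.mem_preimage, Set.mem_compl_iff]
      tauto
    have h2 := abs_le.1 (abs_measureReal_sub_le_measureReal_symmDiff (μ := μ) (hmeas E hE).nullMeasurableSet hS.nullMeasurableSet)
    have h3 := abs_le.1 (abs_measureReal_sub_le_measureReal_symmDiff (μ := μ) (hmeas F hF).nullMeasurableSet hS.compl.nullMeasurableSet)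
    have hS1 : μ.real S ≤ 1 := measureReal_le_one
    have hF1 : μ.real Sᶜ ≤ 1 := measureReal_le_one
    have hE1 : μ.real E ≤ 1 := measureReal_le_one
    have hE0 : 0 ≤ μ.real E := measureReal_nonneg
    have hS0 : 0 ≤ μ.real Sᶜ := measureReal_nonneg
    have : μ.real S * μ.real Sᶜ ≤ μ.real E * μ.real F + 2 * ε := by nlinarith
    nlinarith
  have hz : c * (μ.real S * μ.real Sᶜ) ≤ 0 := by
    apply le_of_forall_pos_le_add
    intro ε hε
    have := hbd (ε / (2 + 2 * c)) (by positivity)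
    rwa [div_mul_cancel₀ _ (by positivity)] at this
  have hz2 : μ.real S * μ.real Sᶜ = 0 := by
    apply le_antisymm _ (by positivity)
    by_contra hcon
    push Not at hcon
    nlinarith [mul_pos hc hcon]
  rw [Filter.eventuallyConst_set']
  rcases mul_eq_zero.1 hz2 with h1 | h1
  · left
    rw [measureReal_eq_zero_iff] at h1
    exact ae_eq_empty.2 h1
  · right
    rw [measureReal_eq_zero_iff] at h1
    exact ae_eq_univ.2 h1

/-- The window of length `m` starting at `s`. -/
def win {M : ℕ} (s : ℤ) (m : ℕ) (x : ℤ → Fin M) : Fin m → Fin M := fun i => x (s + (i : ℕ))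

/-- Block cylinder. -/
def blk {M : ℕ} (s : ℤ) {m : ℕ} (I : Fin m → Fin M) : Set (ℤ → Fin M) := win s m ⁻¹' {I}

theorem mem_blk {M : ℕ} {s : ℤ} {m : ℕ} {I : Fin m → Fin M} {x : ℤ → Fin M} :
    x ∈ blk s I ↔ ∀ i : Fin m, x (s + (i : ℕ)) = I i := by
  simp [blk, win, funext_iff]

theorem measurable_win {M : ℕ} (s : ℤ) (m : ℕ) : Measurable (win (M := M) s m) :=
  measurable_pi_lambda _ fun _ => measurable_pi_apply _

theorem measurableSet_blk {M : ℕ} (s : ℤ) {m : ℕ} (I : Fin m → Fin M) :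
    MeasurableSet (blk s I) := measurable_win s m (measurableSet_singleton I)

theorem cyl_eq {M m : ℕ} (I : Fin m → Fin M) : cyl I = blk (-(m : ℤ)) I := by
  ext x
  simp only [cyl, mem_blk, Set.mem_setOf_eq]
  refine forall_congr' fun i => ?_
  rw [show ((i : ℕ) : ℤ) - (m : ℤ) = -(m : ℤ) + (i : ℕ) by ring]

theorem shift_iter {α : Type*} (k : ℕ) (x : ℤ → α) (n : ℤ) : (shift^[k] x) n = x (n + k) := by
  induction k generalizing n with
  | zero => simp
  | succ k ih =>
    rw [Function.iterate_succ_apply', shift, ih]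
    congr 1; push_cast; ring

theorem win_shift {M : ℕ} (s : ℤ) (m k : ℕ) (x : ℤ → Fin M) :
    win s m (shift^[k] x) = win (s + k) m x := by
  funext i
  simp only [win, shift_iter]
  congr 1; ring

theorem shift_blk {M : ℕ} (s : ℤ) {m : ℕ} (k : ℕ) (I : Fin m → Fin M) :
    shift^[k] ⁻¹' blk s I = blk (s + k) I := by
  ext x; simp [blk, win_shift]

theorem blk_append {M : ℕ} (s : ℤ) {m n : ℕ} (I : Fin m → Fin M) (J : Fin n → Fin M) :
    blk s (Fin.append I J) = blk s I ∩ blk (s + m) J := by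
  ext x
  simp only [mem_blk, Set.mem_inter_iff]
  constructor
  · intro h
    refine ⟨fun i => ?_, fun j => ?_⟩
    · simpa using h (Fin.castAdd n i)
    · have := h (Fin.natAdd m j)
      simp only [Fin.natAdd, Fin.append_right] at this
      rw [← Fin.append_right I J j, Fin.natAdd, ← this]
      congr 1; push_cast; ring
  · rintro ⟨h1, h2⟩ i
    refine Fin.addCases (fun i => ?_) (fun j => ?_) i
    · simpa using h1 i
    · rw [Fin.append_right, ← h2 j]
      congr 1; simp; ring

theorem wprod_append {M d : ℕ}
    (A : Fin M → (EuclideanSpace ℝ (Fin d) →L[ℝ] EuclideanSpace ℝ (Fin d)))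
    {m n : ℕ} (I : Fin m → Fin M) (J : Fin n → Fin M) :
    wprod A (Fin.append I J) = wprod A I * wprod A J := by
  simp only [wprod]
  rw [← List.prod_append, ← List.ofFn_fin_append]
  congr 2
  funext i
  refine Fin.addCases (fun i => ?_) (fun j => ?_) i <;> simp

/-- Summing over all words in a window. -/
theorem sum_win {M : ℕ} (μ : Measure (ℤ → Fin M)) [IsProbabilityMeasure μ]
    (s : ℤ) (m : ℕ) (E : Set (ℤ → Fin M)) :
    ∑ K : Fin m → Fin M, μ.real (E ∩ blk s K) = μ.real E := by
  have h := sum_measureReal_preimage_singleton (μ := μ.restrict E) (Finset.univ : Finset (Fin m → Fin M))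
    (f := win s m) (fun y _ => measurableSet_blk s y)
  simp only [Finset.coe_univ, Set.preimage_univ, measureReal_restrict_apply_univ] at h
  rw [← h]
  refine Finset.sum_congr rfl fun K _ => ?_
  rw [measureReal_restrict_apply (measurable_win s m (measurableSet_singleton K)), Set.inter_comm]
  rfl

theorem inv_blk2 {M : ℕ} {μ : Measure (ℤ → Fin M)} [IsProbabilityMeasure μ]
    (hshift : MeasurePreserving shift μ μ) (s s' u u' : ℤ) (h : s' - s = u' - u) {m n : ℕ}
    (I : Fin m → Fin M) (J : Fin n → Fin M) :
    μ.real (blk s I ∩ blk s' J) = μ.real (blk u I ∩ blk u' J) := by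
  have key : ∀ (s s' : ℤ) (k : ℕ), μ.real (blk (s + k) I ∩ blk (s' + k) J) =
      μ.real (blk s I ∩ blk s' J) := by
    intro s s' k
    rw [← shift_blk, ← shift_blk, ← Set.preimage_inter]
    exact (hshift.iterate k).measureReal_preimage
      ((measurableSet_blk _ _).inter (measurableSet_blk _ _)).nullMeasurableSet
  rcases le_total s u with h1 | h1
  · obtain ⟨k, rfl⟩ := Int.le.dest h1
    obtain rfl : u' = s' + k := by linarith
    exact (key _ _ _).symm
  · obtain ⟨k, rfl⟩ := Int.le.dest h1
    obtain rfl : s' = u' + k := by linarith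
    exact key _ _ _

theorem inv_blk {M : ℕ} {μ : Measure (ℤ → Fin M)} [IsProbabilityMeasure μ]
    (hshift : MeasurePreserving shift μ μ) (s u : ℤ) {m : ℕ}
    (I : Fin m → Fin M) : μ.real (blk s I) = μ.real (blk u I) := by
  have := inv_blk2 hshift s s u u (by ring) I I
  simpa using this

theorem cylinder_win {M : ℕ} {E : Set (ℤ → Fin M)}
    (hE : E ∈ measurableCylinders (fun _ : ℤ => Fin M)) :
    ∃ (s : ℤ) (m : ℕ) (U : Finset (Fin m → Fin M)), E = win s m ⁻¹' (U : Set (Fin m → Fin M)) := by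
  classical
  obtain ⟨t, S, -, rfl⟩ := (mem_measurableCylinders _).1 hE
  obtain ⟨k, hk⟩ : ∃ k : ℕ, ∀ i ∈ t, -(k : ℤ) ≤ i ∧ i < k := by
    refine ⟨t.sup Int.natAbs + 1, fun i hi => ?_⟩
    have : i.natAbs ≤ t.sup Int.natAbs := Finset.le_sup (f := Int.natAbs) hi
    omega
  refine ⟨-(k : ℤ), 2 * k, Finset.univ.filter
    (fun w => ∃ x ∈ cylinder t S, win (-(k : ℤ)) (2 * k) x = w), ?_⟩
  ext x
  simp only [Finset.coe_filter, Finset.mem_univ, true_and, Set.mem_preimage, Set.mem_setOf_eq]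
  refine ⟨fun h => ⟨x, h, rfl⟩, ?_⟩
  rintro ⟨y, hy, hyx⟩
  rw [mem_cylinder] at hy ⊢
  convert hy using 1
  funext ⟨i, hi⟩
  obtain ⟨h1, h2⟩ := hk i hi
  have := congrFun hyx ⟨(i + k).toNat, by omega⟩
  simp only [win] at this
  rw [show -(k : ℤ) + ((i + k).toNat : ℤ) = i by omega] at this
  exact this.symm

theorem erg_shift {M : ℕ} {μ : Measure (ℤ → Fin M)} [IsProbabilityMeasure μ]
    (hshift : MeasurePreserving shift μ μ) (N : ℕ) (c : ℝ) (hc : 0 < c)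
    (h : ∀ (a b : ℕ) (I : Fin a → Fin M) (J : Fin b → Fin M),
      c * (μ.real (blk 0 I) * μ.real (blk 0 J)) ≤ μ.real (blk 0 I ∩ blk (a + N) J)) :
    Ergodic shift μ := by
  have h' : ∀ (a b r : ℕ) (I : Fin a → Fin M) (J : Fin b → Fin M),
      c * (μ.real (blk 0 I) * μ.real (blk 0 J)) ≤ μ.real (blk 0 I ∩ blk (a + N + r) J) := by
    intro a b r I J
    rw [← sum_win μ (a + N) r (blk 0 I ∩ blk (a + N + r) J)]
    have e1 : μ.real (blk 0 J) = ∑ K : Fin r → Fin M, μ.real (blk 0 (Fin.append K J)) := by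
      rw [inv_blk hshift 0 (0 + r), ← sum_win μ 0 r]
      simp only [blk_append, Set.inter_comm]
    rw [e1, Finset.mul_sum, Finset.mul_sum]
    refine Finset.sum_le_sum fun K _ => ?_
    refine (h a _ I (Fin.append K J)).trans (le_of_eq ?_)
    rw [blk_append, Set.inter_assoc, Set.inter_comm (blk _ J)]
  refine erg_crit hshift isSetRing_measurableCylinders (univ_mem_measurableCylinders _)
    generateFrom_measurableCylinders.symm c hc ?_
  intro E hE F hF
  obtain ⟨s, a, U, rfl⟩ := cylinder_win hE
  obtain ⟨s', b, V, rfl⟩ := cylinder_win hF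
  obtain ⟨n, r, hnr⟩ : ∃ n r : ℕ, s' + n = s + a + N + r := by
    refine ⟨(s + a + N - s').toNat, (s' - (s + a + N)).toNat, ?_⟩
    omega
  refine ⟨n, ?_⟩
  have e : win s a ⁻¹' (U : Set (Fin a → Fin M)) ∩ shift^[n] ⁻¹' (win s' b ⁻¹' (V : Set (Fin b → Fin M)))
      = (fun x => (win s a x, win (s' + n) b x)) ⁻¹' ((U ×ˢ V : Finset _) : Set _) := by
    ext x; simp [win_shift]
  rw [e, ← sum_measureReal_preimage_singleton, ← sum_measureReal_preimage_singleton,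
    ← sum_measureReal_preimage_singleton, Finset.sum_mul_sum, Finset.sum_product, Finset.mul_sum]
  · refine Finset.sum_le_sum fun I _ => ?_
    rw [Finset.mul_sum]
    refine Finset.sum_le_sum fun J _ => ?_
    have e2 : (fun x => (win s a x, win (s' + n) b x)) ⁻¹' {(I, J)} = blk s I ∩ blk (s' + n) J := by
      ext x; simp [blk]
    rw [e2, inv_blk2 hshift s (s' + n) 0 (a + N + r) (by linarith)]
    refine le_trans (le_of_eq ?_) (h' a b r I J)
    rw [inv_blk hshift 0 s I, inv_blk hshift 0 s' J]
    rfl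
  · exact fun y _ => ((measurable_win _ _).prodMk (measurable_win _ _)) (measurableSet_singleton y)
  · exact fun y _ => measurable_win _ _ (measurableSet_singleton y)
  · exact fun y _ => measurable_win _ _ (measurableSet_singleton y)

theorem gibbs_lower_mixing_bound_large_t {M d : ℕ} (μ : Measure (ℤ → Fin M))
    [IsProbabilityMeasure μ] (hshift : MeasurePreserving shift μ μ)
    (A : Fin M → (EuclideanSpace ℝ (Fin d) →L[ℝ] EuclideanSpace ℝ (Fin d)))
    (N : ℕ) (δ : ℝ) (hδ : 0 < δ)
    (hprim : ∀ (a b : ℕ) (I : Fin a → Fin M) (J : Fin b → Fin M),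
      δ * (‖wprod A I‖ * ‖wprod A J‖) ≤
        ∑ K : Fin N → Fin M, ‖wprod A I * wprod A K * wprod A J‖)
    (t q : ℝ) (ht : 1 < t) (hq : 1 / t + 1 / q = 1) (C : ℝ) (hC : 0 < C) (P : ℝ)
    (hGibbs : ∀ (n : ℕ) (x : Fin n → Fin M),
      C⁻¹ * (μ (cyl x)).toReal ≤ Real.exp (-(n : ℝ) * P) * ‖wprod A x‖ ^ t ∧
      Real.exp (-(n : ℝ) * P) * ‖wprod A x‖ ^ t ≤ C * (μ (cyl x)).toReal) :
    ∀ (a b : ℕ) (I : Fin a → Fin M) (J : Fin b → Fin M),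
      C⁻¹ * C⁻¹ * Real.exp (-(N : ℝ) * P) * (M : ℝ) ^ (-((N : ℝ) * t / q)) * δ ^ t *
          ((μ (cyl I)).toReal * (μ (cyl J)).toReal) ≤
        (μ (cyl I ∩ shift^[N + b] ⁻¹' cyl J)).toReal := by
  have ht0 : 0 < t := by linarith
  have hM : 0 < M := by
    rcases Nat.eq_zero_or_pos M with h | h
    · subst h
      obtain ⟨x⟩ := nonempty_of_isProbabilityMeasure μ
      exact (x 0).elim0
    · exact h
  have hM' : (0 : ℝ) < M := by exact_mod_cast hM
  -- normalised potentials
  obtain ⟨φ, hφ⟩ : ∃ φ : ∀ n : ℕ, (Fin n → Fin M) → ℝ,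
      ∀ n x, φ n x = Real.exp (-(n : ℝ) * P) * ‖wprod A x‖ ^ t := ⟨_, fun _ _ => rfl⟩
  have hφ0 : ∀ n x, 0 ≤ φ n x := fun n x => by rw [hφ]; positivity
  have hlow : ∀ (n : ℕ) (x : Fin n → Fin M) (s : ℤ), C⁻¹ * μ.real (blk s x) ≤ φ n x := by
    intro n x s
    rw [hφ, inv_blk hshift s (-(n : ℤ)), ← cyl_eq]
    exact (hGibbs n x).1
  have hup : ∀ (n : ℕ) (x : Fin n → Fin M) (s : ℤ), C⁻¹ * φ n x ≤ μ.real (blk s x) := by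
    intro n x s
    rw [hφ, inv_blk hshift s (-(n : ℤ)), ← cyl_eq, inv_mul_le_iff₀ hC]
    exact (hGibbs n x).2
  have hsub : ∀ (m n : ℕ) (x : Fin m → Fin M) (y : Fin n → Fin M),
      φ (m + n) (Fin.append x y) ≤ φ m x * φ n y := by
    intro m n x y
    rw [hφ, hφ, hφ, wprod_append]
    have h1 : ‖wprod A x * wprod A y‖ ^ t ≤ ‖wprod A x‖ ^ t * ‖wprod A y‖ ^ t := by
      rw [← Real.mul_rpow (norm_nonneg _) (norm_nonneg _)]
      exact Real.rpow_le_rpow (norm_nonneg _) (norm_mul_le _ _) ht0.le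
    have h2 : Real.exp (-((m + n : ℕ) : ℝ) * P) = Real.exp (-(m : ℝ) * P) * Real.exp (-(n : ℝ) * P) := by
      rw [← Real.exp_add]; congr 1; push_cast; ring
    rw [h2]
    calc _ ≤ Real.exp (-(m : ℝ) * P) * Real.exp (-(n : ℝ) * P) * (‖wprod A x‖ ^ t * ‖wprod A y‖ ^ t) := by
          gcongr
      _ = _ := by ring
  obtain ⟨D, hD⟩ : ∃ D : ℝ, D = Real.exp (-(N : ℝ) * P) * (M : ℝ) ^ (-((N : ℝ) * t / q)) * δ ^ t :=
    ⟨_, rfl⟩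
  have hDpos : 0 < D := by rw [hD]; positivity
  -- Hölder step
  have hhol : ∀ (a b : ℕ) (I : Fin a → Fin M) (J : Fin b → Fin M),
      D * (φ a I * φ b J) ≤ ∑ K : Fin N → Fin M, φ (a + N + b) (Fin.append (Fin.append I K) J) := by
    intro a b I J
    have h1 : (δ * (‖wprod A I‖ * ‖wprod A J‖)) ^ t ≤ ((M : ℝ) ^ N) ^ (t - 1) *
        ∑ K : Fin N → Fin M, ‖wprod A I * wprod A K * wprod A J‖ ^ t := by
      refine (Real.rpow_le_rpow (by positivity) (hprim a b I J) ht0.le).trans ?_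
      have := Real.rpow_sum_le_const_mul_sum_rpow_of_nonneg (Finset.univ : Finset (Fin N → Fin M))
        (f := fun K => ‖wprod A I * wprod A K * wprod A J‖) ht.le (fun _ _ => norm_nonneg _)
      simpa using this
    have h2 : ((M : ℝ) ^ N) ^ (t - 1) = (M : ℝ) ^ ((N : ℝ) * t / q) := by
      rw [← Real.rpow_natCast, ← Real.rpow_mul hM'.le]
      congr 1
      have : 1 / q = 1 - 1 / t := by linarith
      rw [mul_div_assoc, div_eq_mul_one_div t q, this]
      field_simp
    rw [h2, Real.mul_rpow hδ.le (by positivity), Real.mul_rpow (norm_nonneg _) (norm_nonneg _)] at h1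
    have h3 : (M : ℝ) ^ (-((N : ℝ) * t / q)) * (δ ^ t * (‖wprod A I‖ ^ t * ‖wprod A J‖ ^ t)) ≤
        ∑ K : Fin N → Fin M, ‖wprod A I * wprod A K * wprod A J‖ ^ t := by
      rw [Real.rpow_neg hM'.le, inv_mul_le_iff₀ (by positivity)]
      exact h1
    have h4 : Real.exp (-((a + N + b : ℕ) : ℝ) * P) =
        Real.exp (-(a : ℝ) * P) * Real.exp (-(N : ℝ) * P) * Real.exp (-(b : ℝ) * P) := by
      rw [← Real.exp_add, ← Real.exp_add]; congr 1; push_cast; ring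
    simp only [hφ, wprod_append]
    rw [← Finset.mul_sum, h4, hD]
    calc _ = Real.exp (-(a : ℝ) * P) * Real.exp (-(N : ℝ) * P) * Real.exp (-(b : ℝ) * P) *
          ((M : ℝ) ^ (-((N : ℝ) * t / q)) * (δ ^ t * (‖wprod A I‖ ^ t * ‖wprod A J‖ ^ t))) := by ring
      _ ≤ _ := by gcongr
  have hX : ∀ (a b : ℕ) (I : Fin a → Fin M) (J : Fin b → Fin M),
      D * C⁻¹ * (φ a I * φ b J) ≤ μ.real (blk 0 I ∩ blk (a + N) J) := by
    intro a b I J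
    rw [← sum_win μ a N]
    calc _ = C⁻¹ * (D * (φ a I * φ b J)) := by ring
      _ ≤ C⁻¹ * ∑ K : Fin N → Fin M, φ (a + N + b) (Fin.append (Fin.append I K) J) := by
          gcongr; exact hhol a b I J
      _ ≤ _ := by
          rw [Finset.mul_sum]
          refine Finset.sum_le_sum fun K _ => (hup _ _ 0).trans (le_of_eq ?_)
          rw [blk_append, blk_append, Set.inter_right_comm]
          push_cast
          simp only [zero_add]
  have herg : Ergodic shift μ := by
    refine erg_shift hshift N (D * C⁻¹ * (C⁻¹ * C⁻¹)) (by positivity) fun a b I J => ?_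
    refine le_trans ?_ (hX a b I J)
    rw [mul_assoc (D * C⁻¹)]
    gcongr ?_ * ?_
    calc _ = (C⁻¹ * μ.real (blk 0 I)) * (C⁻¹ * μ.real (blk 0 J)) := by ring
      _ ≤ _ := by
        gcongr
        · exact hφ0 _ _
        · exact hlow _ _ _
        · exact hlow _ _ _
  intro a b I J
  have hgoal : (μ (cyl I ∩ shift^[N + b] ⁻¹' cyl J)).toReal = μ.real (blk 0 I ∩ blk (a + N) J) := by
    rw [cyl_eq, cyl_eq, shift_blk]
    exact inv_blk2 hshift _ _ _ _ (by push_cast; ring) I J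
  have hI : (μ (cyl I)).toReal = μ.real (blk 0 I) := by
    rw [cyl_eq]; exact inv_blk hshift _ _ _
  have hJ : (μ (cyl J)).toReal = μ.real (blk 0 J) := by
    rw [cyl_eq]; exact inv_blk hshift _ _ _
  rw [hgoal, hI, hJ]
  -- the bound by reversed correlations
  have hrev : ∀ k : ℕ, D * (C⁻¹ * C⁻¹) * μ.real (blk 0 J ∩ shift^[k] ⁻¹' blk b I) ≤
      μ.real (blk 0 I ∩ blk (a + N) J) := by
    intro k
    rw [shift_blk, ← sum_win μ b k, Finset.mul_sum,
      inv_blk2 hshift 0 (a + N) (0 + k) (0 + (k + a : ℕ) + N) (by push_cast; ring),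
      ← sum_win μ 0 k]
    refine Finset.sum_le_sum fun L _ => ?_
    have h1 := hX (k + a) b (Fin.append L I) J
    have h2 := hsub b (k + a) J (Fin.append L I)
    have h3 := hlow _ (Fin.append J (Fin.append L I)) 0
    rw [blk_append, blk_append] at h3
    rw [blk_append] at h1
    have e1 : blk 0 J ∩ blk (b + k) I ∩ blk b L =
        blk 0 J ∩ (blk (0 + b) L ∩ blk (0 + b + k) I) := by
      rw [zero_add, Set.inter_assoc, Set.inter_comm (blk _ I)]
    have e2 : blk (0 + k) I ∩ blk (0 + (k + a : ℕ) + N) J ∩ blk 0 L =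
        blk 0 L ∩ blk (0 + k) I ∩ blk ((k + a : ℕ) + N) J := by
      rw [zero_add ((k + a : ℕ) : ℤ)]
      ext x; simp only [Set.mem_inter_iff]; tauto
    rw [e1, e2]
    refine le_trans ?_ h1
    calc _ = D * C⁻¹ * (C⁻¹ * μ.real (blk 0 J ∩ (blk (0 + b) L ∩ blk (0 + b + k) I))) := by ring
      _ ≤ D * C⁻¹ * (φ b J * φ (k + a) (Fin.append L I)) := by
        exact mul_le_mul_of_nonneg_left (h3.trans h2) (by positivity)
      _ = _ := by ring
  have hfin := erg_avg herg (measurableSet_blk (b : ℤ) I) (measurableSet_blk 0 J)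
    (y := μ.real (blk 0 I ∩ blk (a + N) J) / (D * (C⁻¹ * C⁻¹))) (fun k => by
      rw [le_div_iff₀ (by positivity), mul_comm]; exact hrev k)
  rw [le_div_iff₀ (by positivity), inv_blk hshift b 0 I] at hfin
  refine le_trans (le_of_eq ?_) hfin
  rw [hD]; ring
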